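/- For every prime d ≥ 5, let ψ′ be the state of 5 qudits with d levels given by ψ′(x) = 1/d if x = (i, j, i+j, 2i+j, 3i+j) for some i, j ∈ ZMod d and ψ′(x) = 0 otherwise, and let ψ be the state given by ψ(x) = ω^{(3i+j)·ℓ}/√(d³) if x = (i, j, i+j, 2i+j+ℓ, ℓ) for some i, j, ℓ ∈ ZMod d (with ω = exp(2πi/d)) and ψ(x) = 0 otherwise. Then ψ and ψ′ are not SLOCC-equivalent (and hence not LU-equivalent): there exist no invertible d×d complex matrices O_1,…,O_5 and nonzero complex number κ with (O_1⊗⋯⊗O_5)ψ = κ·ψ′. -/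

import Mathlib

/-- Action of the local operator `O_1 ⊗ ⋯ ⊗ O_N` on a multipartite state. -/
noncomputable def applyLocal {ι α : Type} [Fintype ι] [DecidableEq ι] [Fintype α]
    [DecidableEq α] (O : ι → Matrix α α ℂ) (ψ : (ι → α) → ℂ) : (ι → α) → ℂ :=
  fun x => ∑ y : ι → α, (∏ i, O i (x i) (y i)) * ψ y

/-- The minimal-support AME(5,d) state ψ′ with ψ′(i, j, i+j, 2i+j, 3i+j) = 1/d. -/
noncomputable def ameFivePrime (d : ℕ) [NeZero d] : (Fin 5 → ZMod d) → ℂ := fun x =>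
  if x 2 = x 0 + x 1 ∧ x 3 = 2 * x 0 + x 1 ∧ x 4 = 3 * x 0 + x 1
  then ((d : ℂ))⁻¹ else 0

/-- The AME(5,d) state ψ with ψ(i, j, i+j, 2i+j+ℓ, ℓ) = ω^{(3i+j)·ℓ}/√(d³),
where ω = exp(2πi/d). -/
noncomputable def ameFive (d : ℕ) [NeZero d] : (Fin 5 → ZMod d) → ℂ := fun x =>
  if x 2 = x 0 + x 1 ∧ x 3 = 2 * x 0 + x 1 + x 4
  then Complex.exp (2 * Real.pi * Complex.I *
        ((((3 * x 0 + x 1) * x 4 : ZMod d).val : ℂ)) / (d : ℂ)) /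
      ((Real.sqrt (d ^ 3) : ℂ))
  else 0

theorem sum_fin_five {α M : Type*} [Fintype α] [DecidableEq α] [AddCommMonoid M]
    (f : (Fin 5 → α) → M) :
    ∑ y, f y = ∑ p, ∑ q, ∑ r, ∑ s, ∑ t, f ![p, q, r, s, t] := by
  let e : (α × α × α × α × α) ≃ (Fin 5 → α) :=
    { toFun := fun z => ![z.1, z.2.1, z.2.2.1, z.2.2.2.1, z.2.2.2.2]
      invFun := fun y => (y 0, y 1, y 2, y 3, y 4)
      left_inv := fun _ => rfl
      right_inv := fun y => by ext i; fin_cases i <;> rfl }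
  rw [← e.sum_comp f]
  simp only [Fintype.sum_prod_type]
  rfl

/-- A product of two invertible matrices acts injectively on bipartite coefficient functions. -/
theorem eq_zero_of_isUnit_of_sum_mul_eq_zero {n R : Type*} [Fintype n] [DecidableEq n]
    [CommRing R] {A B : Matrix n n R} (hA : IsUnit A) (hB : IsUnit B) {F : n → n → R}
    (h : ∀ x y, ∑ u, ∑ v, A x u * B y v * F u v = 0) (u v : n) : F u v = 0 := by
  have hz : A * Matrix.of F * B.transpose = 0 := by
    ext x y
    rw [Matrix.zero_apply, ← h x y, Matrix.mul_apply]
    simp_rw [Matrix.mul_apply, Finset.sum_mul]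
    rw [Finset.sum_comm]
    refine Finset.sum_congr rfl fun _ _ => Finset.sum_congr rfl fun _ _ => ?_
    simp only [Matrix.of_apply, Matrix.transpose_apply]
    ring
  have hBt : IsUnit B.transpose := by rwa [Matrix.isUnit_transpose]
  rw [hBt.mul_left_eq_zero, hA.mul_right_eq_zero] at hz
  exact congrFun (congrFun hz u) v

theorem exists_row_ne_zero_of_isUnit {n R : Type*} [Fintype n] [DecidableEq n]
    [CommRing R] [Nontrivial R] {A : Matrix n n R} (hA : IsUnit A) (x : n) :
    ∃ u, A x u ≠ 0 := by
  by_contra! h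
  obtain ⟨B, hB⟩ := hA.exists_right_inv
  simpa [Matrix.mul_apply, h] using congrFun (congrFun hB x) x

theorem exists_col_ne_zero_of_isUnit {n R : Type*} [Fintype n] [DecidableEq n]
    [CommRing R] [Nontrivial R] {A : Matrix n n R} (hA : IsUnit A) (u : n) :
    ∃ x, A x u ≠ 0 := by
  by_contra! h
  obtain ⟨B, hB⟩ := hA.exists_left_inv
  simpa [Matrix.mul_apply, h] using congrFun (congrFun hB u) u

/-- If every column of an invertible matrix has at most one nonzero entry, so does every row. -/
theorem row_unique_of_col_unique {n R : Type*} [Fintype n] [DecidableEq n]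
    [CommRing R] [Nontrivial R] {A : Matrix n n R} (hA : IsUnit A)
    (hcol : ∀ u x y, A x u ≠ 0 → A y u ≠ 0 → x = y) {x u v : n}
    (hu : A x u ≠ 0) (hv : A x v ≠ 0) : u = v := by
  choose σ hσ using exists_col_ne_zero_of_isUnit hA
  have hsurj : Function.Surjective σ := fun y => by
    obtain ⟨w, hw⟩ := exists_row_ne_zero_of_isUnit hA y
    exact ⟨w, hcol w _ _ (hσ w) hw⟩
  refine Finite.injective_iff_surjective.mpr hsurj ?_
  rw [hcol u _ _ (hσ u) hu, hcol v _ _ (hσ v) hv]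

theorem ameFive_vec (d : ℕ) [NeZero d] (i j s u l : ZMod d) :
    ameFive d ![i, j, s, u, l] = if s = i + j ∧ u = 2 * i + j + l then
      ZMod.stdAddChar ((3 * i + j) * l) / ((Real.sqrt (d ^ 3) : ℂ)) else 0 := by
  have h : (ZMod.stdAddChar ((3 * i + j) * l) : ℂ) = Complex.exp (2 * Real.pi * Complex.I *
        ((((3 * i + j) * l : ZMod d).val : ℂ)) / (d : ℂ)) := by
    rw [ZMod.stdAddChar_apply, ZMod.toCircle_apply]
  rw [h]
  rfl

theorem sqrt_cube_ne_zero (d : ℕ) [NeZero d] : ((Real.sqrt (d ^ 3) : ℂ)) ≠ 0 := by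
  have : (0 : ℝ) < d := Nat.cast_pos.mpr (NeZero.pos d)
  exact_mod_cast (Real.sqrt_pos.mpr (pow_pos this 3)).ne'

theorem eq_zero_of_sum_mul_stdAddChar_eq_zero {d : ℕ} [NeZero d] {G : ZMod d → ℂ}
    (h : ∀ l, ∑ i, G i * ZMod.stdAddChar (i * l) = 0) : G = 0 := by
  apply ZMod.dft.injective
  rw [map_zero]
  ext k
  rw [ZMod.dft_apply, Pi.zero_apply, ← h (-k)]
  refine Finset.sum_congr rfl fun i _ => ?_
  rw [smul_eq_mul, mul_comm, mul_neg]

/-- The span of the three-party slices of `ameFive` on the parties `0, 1, 2` contains every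
basis vector `|i, j, i + j⟩`. -/
theorem mul_eq_zero_of_ameFive_contract_eq_zero {d : ℕ} [NeZero d] {f g h : ZMod d → ℂ}
    (hz : ∀ u l, ∑ i, ∑ j, ∑ s, f i * g j * h s * ameFive d ![i, j, s, u, l] = 0)
    (i j : ZMod d) : f i * g j * h (i + j) = 0 := by
  set m := 2 * i + j with hm
  have key : (fun i => f i * g (m - 2 * i) * h (m - i)) = 0 := by
    apply eq_zero_of_sum_mul_stdAddChar_eq_zero
    intro l
    have h1 := hz (m + l) l
    have h2 : ∀ p, (∑ q, ∑ s, f p * g q * h s * ameFive d ![p, q, s, m + l, l]) =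
        f p * g (m - 2 * p) * h (m - p) * ZMod.stdAddChar (p * l) *
          (ZMod.stdAddChar (m * l) / ((Real.sqrt (d ^ 3) : ℂ))) := by
      intro p
      rw [Finset.sum_eq_single (m - 2 * p), Finset.sum_eq_single (m - p)]
      · rw [ameFive_vec, if_pos ⟨by ring, by ring⟩,
          show (3 * p + (m - 2 * p)) * l = p * l + m * l by ring, AddChar.map_add_eq_mul]
        ring
      · intro s _ hs
        rw [ameFive_vec, if_neg, mul_zero]
        rintro ⟨rfl, -⟩
        exact hs (by ring)
      · simp
      · intro q _ hq
        refine Finset.sum_eq_zero fun s _ => ?_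
        rw [ameFive_vec, if_neg, mul_zero]
        rintro ⟨-, hu⟩
        exact hq (by linear_combination -hu)
      · simp
    rw [Finset.sum_congr rfl fun p _ => h2 p, ← Finset.sum_mul] at h1
    refine (mul_eq_zero.mp h1).resolve_right (div_ne_zero ?_ (sqrt_cube_ne_zero d))
    exact (AddChar.val_isUnit _ _).ne_zero
  have h3 := congrFun key i
  simp only [Pi.zero_apply] at h3
  rwa [show m - 2 * i = j by rw [hm]; ring, show m - i = i + j by rw [hm]; ring] at h3

section

variable {d : ℕ} [NeZero d] {O : Fin 5 → Matrix (ZMod d) (ZMod d) ℂ} {κ : ℂ}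

theorem sum_eq_smul_ameFivePrime (hO : applyLocal O (ameFive d) = κ • ameFivePrime d)
    (a b c k l : ZMod d) :
    ∑ p, ∑ q, ∑ r, ∑ s, ∑ t, O 0 a p * O 1 b q * O 2 c r * O 3 k s * O 4 l t *
      ameFive d ![p, q, r, s, t] = κ * ameFivePrime d ![a, b, c, k, l] := by
  have h := congrFun hO ![a, b, c, k, l]
  rw [applyLocal, sum_fin_five] at h
  simp only [Fin.prod_univ_five] at h
  exact h

theorem triple_eq_zero (hU : ∀ i, IsUnit (O i))
    (hO : applyLocal O (ameFive d) = κ • ameFivePrime d) {a b c : ZMod d} (hc : c ≠ a + b)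
    (i j : ZMod d) : O 0 a i * O 1 b j * O 2 c (i + j) = 0 := by
  refine mul_eq_zero_of_ameFive_contract_eq_zero (f := O 0 a) (g := O 1 b) (h := O 2 c) ?_ i j
  refine eq_zero_of_isUnit_of_sum_mul_eq_zero (hU 3) (hU 4) fun k l => ?_
  have h := sum_eq_smul_ameFivePrime hO a b c k l
  rw [show ameFivePrime d ![a, b, c, k, l] = 0 from if_neg fun h => hc h.1, mul_zero] at h
  rw [← h]
  simp only [← Fintype.sum_prod_type', Finset.mul_sum]
  exact Fintype.sum_equiv ⟨fun x => (x.2.2.1, x.2.2.2.1, x.2.2.2.2, x.1, x.2.1),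
    fun x => (x.2.2.2.1, x.2.2.2.2, x.1, x.2.1, x.2.2.1), fun _ => rfl, fun _ => rfl⟩ _ _
    fun _ => by simp only [Equiv.coe_fn_mk]; ring

theorem contract_two_four_eq_zero (hU : ∀ i, IsUnit (O i))
    (hO : applyLocal O (ameFive d) = κ • ameFivePrime d) {a b k : ZMod d} (hk : k ≠ 2 * a + b)
    (s l : ZMod d) :
    ∑ i, ∑ j, ∑ u, O 0 a i * O 1 b j * O 3 k u * ameFive d ![i, j, s, u, l] = 0 := by
  revert s l
  refine eq_zero_of_isUnit_of_sum_mul_eq_zero (hU 2) (hU 4) fun c l => ?_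
  have h := sum_eq_smul_ameFivePrime hO a b c k l
  rw [show ameFivePrime d ![a, b, c, k, l] = 0 from if_neg fun h => hk h.2.1, mul_zero] at h
  rw [← h]
  simp only [← Fintype.sum_prod_type', Finset.mul_sum]
  exact Fintype.sum_equiv ⟨fun x => (x.2.2.1, x.2.2.2.1, x.1, x.2.2.2.2, x.2.1),
    fun x => (x.2.2.1, x.2.2.2.2, x.1, x.2.1, x.2.2.2.1), fun _ => rfl, fun _ => rfl⟩ _ _
    fun _ => by simp only [Equiv.coe_fn_mk]; ring

end

/-- For every prime d ≥ 5 the AME(5,d) states ψ and ψ′ are not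
SLOCC-equivalent: no invertible local operator maps ψ to a nonzero multiple of ψ′. -/
theorem ameFive_not_slocc_equiv (d : ℕ) [NeZero d] (hd : d.Prime) (hd5 : 5 ≤ d) :
    ¬ ∃ (O : Fin 5 → Matrix (ZMod d) (ZMod d) ℂ) (κ : ℂ),
        (∀ i, IsUnit (O i)) ∧ κ ≠ 0 ∧
        applyLocal O (ameFive d) = κ • ameFivePrime d := by
  rintro ⟨O, κ, hU, -, hO⟩
  have : Fact (1 < d) := ⟨hd.one_lt⟩
  have hsum : ∀ {a b c i j}, O 0 a i ≠ 0 → O 1 b j ≠ 0 → O 2 c (i + j) ≠ 0 → c = a + b := by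
    intro a b c i j h0 h1 h2
    by_contra hc
    exact mul_ne_zero (mul_ne_zero h0 h1) h2 (triple_eq_zero hU hO hc i j)
  have hcol0 : ∀ i a a', O 0 a i ≠ 0 → O 0 a' i ≠ 0 → a = a' := by
    intro i a a' h h'
    obtain ⟨b, hb⟩ := exists_col_ne_zero_of_isUnit (hU 1) 0
    obtain ⟨c, hc⟩ := exists_col_ne_zero_of_isUnit (hU 2) (i + 0)
    exact add_right_cancel ((hsum h hb hc).symm.trans (hsum h' hb hc))
  have hcol1 : ∀ j b b', O 1 b j ≠ 0 → O 1 b' j ≠ 0 → b = b' := by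
    intro j b b' h h'
    obtain ⟨a, ha⟩ := exists_col_ne_zero_of_isUnit (hU 0) 0
    obtain ⟨c, hc⟩ := exists_col_ne_zero_of_isUnit (hU 2) (0 + j)
    exact add_left_cancel ((hsum ha h hc).symm.trans (hsum ha h' hc))
  obtain ⟨i, hi⟩ := exists_row_ne_zero_of_isUnit (hU 0) 0
  obtain ⟨j, hj⟩ := exists_row_ne_zero_of_isUnit (hU 1) 0
  obtain ⟨u, hu⟩ := exists_row_ne_zero_of_isUnit (hU 3) 1
  have hz := contract_two_four_eq_zero hU hO (a := 0) (b := 0) (k := 1) (by simp)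
    (i + j) (u - 2 * i - j)
  rw [Fintype.sum_eq_single i, Fintype.sum_eq_single j, Fintype.sum_eq_single u] at hz
  · rw [ameFive_vec, if_pos ⟨rfl, by ring⟩] at hz
    exact mul_ne_zero (mul_ne_zero (mul_ne_zero hi hj) hu)
      (div_ne_zero (AddChar.val_isUnit _ _).ne_zero (sqrt_cube_ne_zero d)) hz
  · intro v hv
    rw [ameFive_vec, if_neg, mul_zero]
    rintro ⟨-, h⟩
    exact hv (by linear_combination h)
  · intro q hq
    have : O 1 0 q = 0 := by
      by_contra h
      exact hq (row_unique_of_col_unique (hU 1) hcol1 h hj)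
    simp [this]
  · intro p hp
    have : O 0 0 p = 0 := by
      by_contra h
      exact hp (row_unique_of_col_unique (hU 0) hcol0 h hi)
    simp [this]
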